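/- arXiv:2211.02859 — 2 statements merged into one kernel-verified Lean document; each statement's English description precedes it below -/
import Mathlib

section
/- Let V be a weak lower perfect space with lower perfect basis B. For any b ∈ B and any (i,l) ∈ I^∞, one has d_{il}(b) = max{n ≥ 0 : b ∈ 𝐟_{il}^n(B)}, where 𝐟_{il}^n(B) denotes the set of n-fold applications of the map 𝐟_{il} to elements of B. -/
noncomputable section

open Function Set

/-- An even symmetrizable Borcherds–Cartan datum: a countable index set `I`, an
even symmetrizable Borcherds–Cartan matrix `a`, a symmetrizing diagonal `s`,
a free abelian weight lattice `P` and linearly independent simple roots `α`. -/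
structure BCDatum (I : Type*) (P : Type*) [AddCommGroup P] where
  a : I → I → ℤ
  s : I → ℤ
  α : I → P
  countable_index : Countable I
  even_diag : ∀ i, Even (a i i)
  diag_le_two : ∀ i, a i i ≤ 2
  offdiag_nonpos : ∀ i j, i ≠ j → a i j ≤ 0
  s_pos : ∀ i, 0 < s i
  symmetrizable : ∀ i j, s i * a i j = s j * a j i
  free_weight : Module.Free ℤ P
  roots_indep : LinearIndependent ℤ α

namespace BCDatum

variable {I P : Type*} [AddCommGroup P] (D : BCDatum I P)

/-- `I^∞ = I^re ⊔ (I^im × ℤ_{>0})`. -/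
abbrev Iinf : Type _ := {i : I // D.a i i = 2} ⊕ ({i : I // D.a i i ≤ 0} × ℕ+)

/-- The weight `l·α_i` attached to an element of `I^∞` (with `l = 1` in the real case). -/
def wtOf (x : D.Iinf) : P :=
  Sum.elim (fun i => D.α i.1) (fun p => (p.2 : ℕ) • D.α p.1.1) x

/-- `R_+ = Σ_i ℤ_{≥0} α_i`. -/
def Rplus : Set P := {μ | ∃ c : I →₀ ℕ, μ = c.sum fun i n => n • D.α i}

end BCDatum

/-- A good sequence of indices: every element of `I^∞` appears infinitely often. -/
def GoodIdxSeq {I P : Type*} [AddCommGroup P] {D : BCDatum I P} (gi : ℕ → D.Iinf) : Prop :=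
  ∀ x : D.Iinf, ∀ N : ℕ, ∃ n, N ≤ n ∧ gi n = x

/-- Lexicographic strict order on integer sequences: `SeqLt a b` means `a < b`. -/
def SeqLt (a b : ℕ → ℕ) : Prop := ∃ m, (∀ s, s < m → a s = b s) ∧ a m < b m

/-- Lexicographic order: `SeqLe a b` means `a ≤ b`. -/
def SeqLe (a b : ℕ → ℕ) : Prop := a = b ∨ SeqLt a b

/-- A good sequence of nonnegative integers: eventually zero. -/
def GoodNatSeq (a : ℕ → ℕ) : Prop := ∃ N, ∀ n, N ≤ n → a n = 0

/-- A weak lower perfect space over a Borcherds–Cartan datum `D`: a `P`-graded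
`k`-vector space with finite dimensional weight spaces, weights bounded by
finitely many `λ_j - R_+`, together with endomorphisms `f x = 𝚏_{il}`
lowering the weight by `l·α_i`. -/
structure WeakLowerPerfect {I P : Type*} [AddCommGroup P] (D : BCDatum I P)
    (k : Type*) [Field k] (V : Type*) [AddCommGroup V] [Module k V] where
  wtSp : P → Submodule k V
  wt_indep : iSupIndep wtSp
  wt_total : ⨆ μ, wtSp μ = ⊤
  wt_findim : ∀ μ, FiniteDimensional k (wtSp μ)
  wt_bdd : ∃ Λ : Finset P, ∀ μ, wtSp μ ≠ ⊥ → ∃ lam ∈ Λ, ∃ β ∈ D.Rplus, μ = lam - β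
  f : D.Iinf → Module.End k V
  f_wt : ∀ x μ, ∀ v ∈ wtSp μ, f x v ∈ wtSp (μ - D.wtOf x)

namespace WeakLowerPerfect

variable {I P : Type*} [AddCommGroup P] {D : BCDatum I P}
  {k : Type*} [Field k] {V : Type*} [AddCommGroup V] [Module k V]

/-- `d_{il}(v)`: the largest `n` with `v ∈ 𝚏_{il}^n V` (for `v ≠ 0` in a weak
lower perfect space this is the unique `n` with `v ∈ 𝚏^n V \ 𝚏^{n+1} V`). -/
def d (W : WeakLowerPerfect D k V) (x : D.Iinf) (v : V) : ℕ :=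
  sSup {n | v ∈ LinearMap.range (W.f x ^ n)}

/-- The composite `𝚏_{i_1l_1}^{a_1} ⋯ 𝚏_{i_rl_r}^{a_r}` (`0`-based indexing). -/
def prodF (W : WeakLowerPerfect D k V) (gi : ℕ → D.Iinf) (a : ℕ → ℕ) (r : ℕ) :
    Module.End k V :=
  ((List.range r).map fun j => W.f (gi j) ^ a j).prod

/-- `V^{>𝐢,𝐚} = Σ_{k=1}^r 𝚏_{i_1l_1}^{a_1}⋯𝚏_{i_{k-1}l_{k-1}}^{a_{k-1}} 𝚏_{i_kl_k}^{a_k+1} V`. -/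
def Vgt (W : WeakLowerPerfect D k V) (gi : ℕ → D.Iinf) (a : ℕ → ℕ) (r : ℕ) :
    Submodule k V :=
  ⨆ j ∈ Finset.range r, LinearMap.range (W.prodF gi a j * W.f (gi j) ^ (a j + 1))

/-- `V^{≥𝐢,𝐚} = V^{>𝐢,𝐚} + 𝚏_{i_1l_1}^{a_1}⋯𝚏_{i_rl_r}^{a_r} V`. -/
def Vge (W : WeakLowerPerfect D k V) (gi : ℕ → D.Iinf) (a : ℕ → ℕ) (r : ℕ) :
    Submodule k V :=
  W.Vgt gi a r ⊔ LinearMap.range (W.prodF gi a r)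

end WeakLowerPerfect

/-- A lower perfect basis of a weak lower perfect space: a basis compatible with the
grading, equipped with crystal-type maps `𝐟_{il} : B → B ∪ {0}` approximating the
`𝚏_{il}` modulo `𝚏_{il}^{d_{il}(b)+2} V`, jointly injective. (The maps `flo` are
extended to all of `V`, with the convention `flo x 0 = 0`.) -/
structure LowerPerfectBasis {I P : Type*} [AddCommGroup P] {D : BCDatum I P}
    {k : Type*} [Field k] {V : Type*} [AddCommGroup V] [Module k V]
    (W : WeakLowerPerfect D k V) where
  B : Set V
  linIndep : LinearIndependent k (Subtype.val : B → V)
  spans : Submodule.span k B = ⊤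
  graded : ∀ b ∈ B, ∃ μ, b ∈ W.wtSp μ
  flo : D.Iinf → V → V
  flo_mem : ∀ x, ∀ b ∈ B, flo x b ∈ B ∨ flo x b = 0
  flo_zero : ∀ x, flo x 0 = 0
  flo_approx : ∀ x, ∀ b ∈ B, ∃ c : k, c ≠ 0 ∧
    W.f x b - c • flo x b ∈ LinearMap.range (W.f x ^ (W.d x b + 2))
  flo_joint_inj : ∀ b ∈ B, ∀ b' ∈ B, (∀ x, flo x b = flo x b') → b = b'

namespace LowerPerfectBasis

variable {I P : Type*} [AddCommGroup P] {D : BCDatum I P}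
  {k : Type*} [Field k] {V : Type*} [AddCommGroup V] [Module k V]
  {W : WeakLowerPerfect D k V}

open Classical in
/-- `𝐞_{il} : B → B ∪ {0}`: `𝐞_{il}(b) = b'` if `b = 𝐟_{il}(b')` with `b' ∈ B`,
and `𝐞_{il}(b) = 0` otherwise. -/
def elo (L : LowerPerfectBasis W) (x : D.Iinf) (b : V) : V :=
  if h : b ∈ L.B ∧ ∃ b' ∈ L.B, L.flo x b' = b then h.2.choose else 0

/-- `𝐞_{il}^{top}(b) = 𝐞_{il}^{d_{il}(b)}(b)`. -/
def etop (L : LowerPerfectBasis W) (x : D.Iinf) (b : V) : V :=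
  (L.elo x)^[W.d x b] b

/-- The sequence `b_0 = b`, `b_{k+1} = 𝐞_{i_{k+1}l_{k+1}}^{top}(b_k)` (0-based). -/
def bseq (L : LowerPerfectBasis W) (gi : ℕ → D.Iinf) (b : V) (n : ℕ) : V :=
  Nat.rec (motive := fun _ => V) b (fun m prev => L.etop (gi m) prev) n

/-- The sequence `𝐝(𝐢,b)`: `d_k = d_{i_kl_k}(b_{k-1})` (0-based). -/
def dseq (L : LowerPerfectBasis W) (gi : ℕ → D.Iinf) (b : V) (n : ℕ) : ℕ :=
  W.d (gi n) (L.bseq gi b n)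

/-- The highest core `B_H = {b ∈ B : d_{il}(b) = 0 for all (i,l)}`. -/
def BH (L : LowerPerfectBasis W) : Set V := {b ∈ L.B | ∀ x, W.d x b = 0}

/-- The iterated crystal map `𝐟_{i_1l_1}^{a_1} ⋯ 𝐟_{i_rl_r}^{a_r}` (0-based). -/
def floSeq (L : LowerPerfectBasis W) (gi : ℕ → D.Iinf) (a : ℕ → ℕ) (r : ℕ) : V → V :=
  Nat.rec (motive := fun _ => V → V) id
    (fun n F => fun b => F ((L.flo (gi n))^[a n] b)) r

/-- The iterated crystal map `𝐞_{i_rl_r}^{a_r} ⋯ 𝐞_{i_1l_1}^{a_1}` (0-based). -/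
def eloSeq (L : LowerPerfectBasis W) (gi : ℕ → D.Iinf) (a : ℕ → ℕ) (r : ℕ) : V → V :=
  Nat.rec (motive := fun _ => V → V) id
    (fun n F => fun b => (L.elo (gi n))^[a n] (F b)) r

end LowerPerfectBasis

/-- A weak upper perfect space: like a weak lower perfect space, but the
endomorphisms `e x = 𝚎_{il}` raise the weight by `l·α_i`. -/
structure WeakUpperPerfect {I P : Type*} [AddCommGroup P] (D : BCDatum I P)
    (k : Type*) [Field k] (V : Type*) [AddCommGroup V] [Module k V] where
  wtSp : P → Submodule k V
  wt_indep : iSupIndep wtSp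
  wt_total : ⨆ μ, wtSp μ = ⊤
  wt_findim : ∀ μ, FiniteDimensional k (wtSp μ)
  wt_bdd : ∃ Λ : Finset P, ∀ μ, wtSp μ ≠ ⊥ → ∃ lam ∈ Λ, ∃ β ∈ D.Rplus, μ = lam - β
  e : D.Iinf → Module.End k V
  e_wt : ∀ x μ, ∀ v ∈ wtSp μ, e x v ∈ wtSp (μ + D.wtOf x)

namespace WeakUpperPerfect

variable {I P : Type*} [AddCommGroup P] {D : BCDatum I P}
  {k : Type*} [Field k] {V : Type*} [AddCommGroup V] [Module k V]

/-- `d^∨_{il}(v) = max{n ≥ 0 : 𝚎_{il}^n v ≠ 0}`. -/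
def dv (W : WeakUpperPerfect D k V) (x : D.Iinf) (v : V) : ℕ :=
  sSup {n | (W.e x ^ n) v ≠ 0}

end WeakUpperPerfect

/-- An upper perfect basis of a weak upper perfect space. -/
structure UpperPerfectBasis {I P : Type*} [AddCommGroup P] {D : BCDatum I P}
    {k : Type*} [Field k] {V : Type*} [AddCommGroup V] [Module k V]
    (W : WeakUpperPerfect D k V) where
  B : Set V
  linIndep : LinearIndependent k (Subtype.val : B → V)
  spans : Submodule.span k B = ⊤
  graded : ∀ b ∈ B, ∃ μ, b ∈ W.wtSp μ
  Elo : D.Iinf → V → V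
  Elo_zero : ∀ x, ∀ b ∈ B, W.dv x b = 0 → Elo x b = 0
  Elo_mem : ∀ x, ∀ b ∈ B, 0 < W.dv x b → Elo x b ∈ B
  Elo_approx : ∀ x, ∀ b ∈ B, 0 < W.dv x b → ∃ c : k, c ≠ 0 ∧
    W.e x b - c • Elo x b ∈ LinearMap.ker (W.e x ^ (W.dv x b - 1))
  Elo_joint_inj : ∀ b ∈ B, ∀ b' ∈ B, (∀ x, Elo x b = Elo x b') → b = b'

/-- A bilinear pairing realizing `V'` as the graded dual of the weak lower perfect
space `V`, with `𝚎_{il}` adjoint to `𝚏_{il}`. -/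
structure IsGradedDualPair {I P : Type*} [AddCommGroup P] {D : BCDatum I P}
    {k : Type*} [Field k] {V V' : Type*} [AddCommGroup V] [Module k V]
    [AddCommGroup V'] [Module k V']
    (W : WeakLowerPerfect D k V) (W' : WeakUpperPerfect D k V')
    (pr : V →ₗ[k] V' →ₗ[k] k) : Prop where
  orth : ∀ μ ν, μ ≠ ν → ∀ u ∈ W.wtSp μ, ∀ v ∈ W'.wtSp ν, pr u v = 0
  nondeg : ∀ μ, ∀ v ∈ W'.wtSp μ, (∀ u ∈ W.wtSp μ, pr u v = 0) → v = 0
  onto_dual : ∀ μ, ∀ φ : Module.Dual k (W.wtSp μ), ∃ v ∈ W'.wtSp μ,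
      ∀ u : W.wtSp μ, pr (↑u) v = φ u
  adjoint : ∀ x (u : V) (v : V'), pr u (W'.e x v) = pr (W.f x u) v

open Classical in
/-- `dB` sends each `b ∈ B` to the corresponding dual basis vector `b^∨`
(characterized by `⟨b'', b^∨⟩ = δ_{b'' b}` and living in the dual weight space). -/
def IsDualFamily {I P : Type*} [AddCommGroup P] {D : BCDatum I P}
    {k : Type*} [Field k] {V V' : Type*} [AddCommGroup V] [Module k V]
    [AddCommGroup V'] [Module k V']
    (W : WeakLowerPerfect D k V) (W' : WeakUpperPerfect D k V')
    (pr : V →ₗ[k] V' →ₗ[k] k) (B : Set V) (dB : V → V') : Prop :=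
  (∀ b ∈ B, ∀ b' ∈ B, pr b' (dB b) = if b' = b then (1 : k) else 0) ∧
  (∀ b ∈ B, ∀ μ, b ∈ W.wtSp μ → dB b ∈ W'.wtSp μ)


namespace BCDatum

variable {I P : Type*} [AddCommGroup P] (D : BCDatum I P)

theorem exists_wtOf_eq (x : D.Iinf) : ∃ (i : I) (l : ℕ), 0 < l ∧ D.wtOf x = l • D.α i := by
  rcases x with i | p
  · exact ⟨i.1, 1, one_pos, by simp [wtOf]⟩
  · exact ⟨p.1.1, p.2, p.2.pos, rfl⟩

/-- Only finitely many of the weights `μ + n (l α_i)` lie in `lam - R_+`. -/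
theorem exists_bound_of_add_nsmul_wtOf (x : D.Iinf) (μ lam : P) :
    ∃ M : ℕ, ∀ n : ℕ, (∃ β ∈ D.Rplus, μ + n • D.wtOf x = lam - β) → n ≤ M := by
  obtain ⟨i, l, hl, hx⟩ := D.exists_wtOf_eq x
  have hind : LinearIndependent ℕ D.α :=
    D.roots_indep.restrict_scalars (R := ℕ) fun a b h => by simpa using h
  have key : ∀ n : ℕ, (∃ β ∈ D.Rplus, μ + n • D.wtOf x = lam - β) →
      ∃ c : I →₀ ℕ, n ≤ c i ∧ Finsupp.linearCombination ℕ D.α c = lam - μ := by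
    rintro n ⟨_, ⟨c, rfl⟩, h⟩
    refine ⟨Finsupp.single i (n * l) + c, ?_, ?_⟩
    · simpa using le_add_right (Nat.le_mul_of_pos_right n hl)
    · rw [map_add, Finsupp.linearCombination_single, Finsupp.linearCombination_apply, mul_smul,
        ← hx, eq_sub_iff_add_eq, add_right_comm, add_comm _ μ, h, sub_add_cancel]
  by_cases hc : ∃ c : I →₀ ℕ, Finsupp.linearCombination ℕ D.α c = lam - μ
  · obtain ⟨c, hc⟩ := hc
    refine ⟨c i, fun n hn => ?_⟩
    obtain ⟨c', hle, hc'⟩ := key n hn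
    have hcc : c' = c := hind (hc'.trans hc.symm)
    exact hcc ▸ hle
  · refine ⟨0, fun n hn => ?_⟩
    obtain ⟨c, -, h⟩ := key n hn
    exact (hc ⟨c, h⟩).elim

end BCDatum

namespace WeakLowerPerfect

variable {I P : Type*} [AddCommGroup P] {D : BCDatum I P}
  {k : Type*} [Field k] {V : Type*} [AddCommGroup V] [Module k V] (W : WeakLowerPerfect D k V)

/-- The projection of `V` onto a weight space along the others. -/
theorem exists_wtProj (μ : P) : ∃ p : Module.End k V,
    (∀ v ∈ W.wtSp μ, p v = v) ∧ ∀ ν, ν ≠ μ → ∀ v ∈ W.wtSp ν, p v = 0 := by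
  classical
  have hint : DirectSum.IsInternal W.wtSp :=
    DirectSum.isInternal_submodule_of_iSupIndep_of_iSup_eq_top W.wt_indep W.wt_total
  let _ := hint.chooseDecomposition
  refine ⟨(W.wtSp μ).subtype ∘ₗ DirectSum.component k P (fun ν => W.wtSp ν) μ ∘ₗ
    (DirectSum.decomposeLinearEquiv W.wtSp).toLinearMap, fun v hv => ?_, fun ν hν v hv => ?_⟩
  · exact DirectSum.decompose_of_mem_same W.wtSp hv
  · exact DirectSum.decompose_of_mem_ne W.wtSp hv hν

theorem pow_f_mem_wtSp (x : D.Iinf) (n : ℕ) {ν : P} {v : V} (hv : v ∈ W.wtSp ν) :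
    (W.f x ^ n) v ∈ W.wtSp (ν - n • D.wtOf x) := by
  induction n with
  | zero => simpa using hv
  | succ n ih =>
    rw [pow_succ', Module.End.mul_apply, succ_nsmul, ← sub_sub]
    exact W.f_wt _ _ _ ih

theorem exists_bound_wtSp_add_eq_bot (x : D.Iinf) (μ : P) :
    ∃ N : ℕ, ∀ n, N ≤ n → W.wtSp (μ + n • D.wtOf x) = ⊥ := by
  obtain ⟨Λ, hΛ⟩ := W.wt_bdd
  choose M hM using D.exists_bound_of_add_nsmul_wtOf x μ
  refine ⟨Λ.sup M + 1, fun n hn => ?_⟩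
  by_contra hne
  obtain ⟨lam, hlam, hβ⟩ := hΛ _ hne
  have h₁ := hM lam n hβ
  have h₂ : M lam ≤ Λ.sup M := Finset.le_sup hlam
  omega

theorem proj_range_pow_eq_zero (x : D.Iinf) {μ : P} {p : Module.End k V}
    (hp : ∀ ν, ν ≠ μ → ∀ v ∈ W.wtSp ν, p v = 0) {n : ℕ}
    (hn : W.wtSp (μ + n • D.wtOf x) = ⊥) {w : V} (hw : w ∈ LinearMap.range (W.f x ^ n)) :
    p w = 0 := by
  obtain ⟨v, rfl⟩ := hw
  have hv : v ∈ ⨆ ν, W.wtSp ν := W.wt_total ▸ Submodule.mem_top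
  induction hv using Submodule.iSup_induction' with
  | mem ν v hv =>
    by_cases h : ν - n • D.wtOf x = μ
    · rw [sub_eq_iff_eq_add.mp h, hn, Submodule.mem_bot] at hv
      simp [hv]
    · exact hp _ h _ (W.pow_f_mem_wtSp x n hv)
  | zero => simp
  | add a b _ _ ha hb => simp [ha, hb]

theorem range_pow_anti (x : D.Iinf) {m n : ℕ} (h : m ≤ n) :
    LinearMap.range (W.f x ^ n) ≤ LinearMap.range (W.f x ^ m) := by
  obtain ⟨r, rfl⟩ := Nat.exists_eq_add_of_le h
  rw [pow_add]
  exact LinearMap.range_comp_le_range _ _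

theorem f_mem_range_pow_succ (x : D.Iinf) (n : ℕ) {v : V} (hv : v ∈ LinearMap.range (W.f x ^ n)) :
    W.f x v ∈ LinearMap.range (W.f x ^ (n + 1)) := by
  obtain ⟨u, rfl⟩ := hv
  exact ⟨u, by rw [pow_succ', Module.End.mul_apply]⟩

end WeakLowerPerfect

namespace LowerPerfectBasis

variable {I P : Type*} [AddCommGroup P] {D : BCDatum I P}
  {k : Type*} [Field k] {V : Type*} [AddCommGroup V] [Module k V]
  {W : WeakLowerPerfect D k V} (L : LowerPerfectBasis W)

theorem ne_zero_of_mem {b : V} (hb : b ∈ L.B) : b ≠ 0 :=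
  L.linIndep.ne_zero ⟨b, hb⟩

theorem bddAbove_range_pow (x : D.Iinf) {b : V} (hb : b ∈ L.B) :
    BddAbove {n | b ∈ LinearMap.range (W.f x ^ n)} := by
  obtain ⟨μ, hμ⟩ := L.graded b hb
  obtain ⟨p, hp, hp'⟩ := W.exists_wtProj μ
  obtain ⟨N, hN⟩ := W.exists_bound_wtSp_add_eq_bot x μ
  refine ⟨N, fun n hn => le_of_not_ge fun hle => L.ne_zero_of_mem hb ?_⟩
  rw [← hp b hμ]
  exact W.proj_range_pow_eq_zero x hp' (hN n hle) hn

theorem mem_range_pow_d (x : D.Iinf) {b : V} (hb : b ∈ L.B) :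
    b ∈ LinearMap.range (W.f x ^ W.d x b) :=
  Nat.sSup_mem (s := {n | b ∈ LinearMap.range (W.f x ^ n)}) ⟨0, b, by simp⟩
    (L.bddAbove_range_pow x hb)

theorem le_d (x : D.Iinf) {b : V} (hb : b ∈ L.B) {n : ℕ}
    (hn : b ∈ LinearMap.range (W.f x ^ n)) : n ≤ W.d x b :=
  le_csSup (L.bddAbove_range_pow x hb) hn

theorem flo_mem_range (x : D.Iinf) {b : V} (hb : b ∈ L.B) :
    L.flo x b ∈ LinearMap.range (W.f x ^ (W.d x b + 1)) := by
  obtain ⟨c, hc, h⟩ := L.flo_approx x b hb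
  have h₁ := W.f_mem_range_pow_succ x _ (L.mem_range_pow_d x hb)
  have h₂ := W.range_pow_anti x (Nat.le_succ (W.d x b + 1)) h
  have h₃ := Submodule.sub_mem _ h₁ h₂
  rw [sub_sub_cancel] at h₃
  exact (Submodule.smul_mem_iff _ hc).mp h₃

theorem iterate_flo_mem (x : D.Iinf) (n : ℕ) {b : V} (hb : b ∈ L.B) :
    (L.flo x)^[n] b ∈ L.B ∨ (L.flo x)^[n] b = 0 := by
  induction n with
  | zero => exact Or.inl hb
  | succ n ih =>
    rw [Function.iterate_succ_apply']
    rcases ih with h | h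
    · exact L.flo_mem x _ h
    · exact Or.inr (by rw [h, L.flo_zero])

theorem iterate_flo_mem_range (x : D.Iinf) (n : ℕ) {b : V} (hb : b ∈ L.B) :
    (L.flo x)^[n] b ∈ LinearMap.range (W.f x ^ n) := by
  induction n with
  | zero => exact ⟨b, by simp⟩
  | succ n ih =>
    rw [Function.iterate_succ_apply']
    rcases L.iterate_flo_mem x n hb with h | h
    · exact W.range_pow_anti x (Nat.succ_le_succ (L.le_d x h ih)) (L.flo_mem_range x h)
    · rw [h, L.flo_zero]
      exact Submodule.zero_mem _

theorem le_d_of_mem_image (x : D.Iinf) {b : V} (hb : b ∈ L.B) {n : ℕ}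
    (hn : b ∈ (L.flo x)^[n] '' L.B) : n ≤ W.d x b := by
  obtain ⟨b', hb', rfl⟩ := hn
  exact L.le_d x hb (L.iterate_flo_mem_range x n hb')

theorem range_pow_le_span_image_sup (x : D.Iinf) (n : ℕ) :
    LinearMap.range (W.f x ^ n) ≤
      Submodule.span k ((L.flo x)^[n] '' L.B) ⊔ LinearMap.range (W.f x ^ (n + 1)) := by
  induction n with
  | zero => simp [L.spans]
  | succ n ih =>
    rw [pow_succ', Module.End.mul_eq_comp, LinearMap.range_comp]
    refine (Submodule.map_mono ih).trans ?_
    rw [Submodule.map_sup, Submodule.map_span]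
    refine sup_le (Submodule.span_le.mpr ?_) ?_
    · rintro _ ⟨_, ⟨b, hb, rfl⟩, rfl⟩
      rcases L.iterate_flo_mem x n hb with h | h
      · obtain ⟨c, -, hc⟩ := L.flo_approx x _ h
        have hd := L.le_d x h (L.iterate_flo_mem_range x n hb)
        rw [SetLike.mem_coe, ← add_sub_cancel (c • L.flo x ((L.flo x)^[n] b))
          (W.f x ((L.flo x)^[n] b))]
        refine Submodule.add_mem_sup (Submodule.smul_mem _ _ (Submodule.subset_span
          ⟨b, hb, Function.iterate_succ_apply' _ _ _⟩))
          (W.range_pow_anti x (by omega) hc)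
      · simp [h]
    · rintro _ ⟨v, hv, rfl⟩
      exact Submodule.mem_sup_right (W.f_mem_range_pow_succ x _ hv)

theorem range_pow_le_span_iUnion_sup (x : D.Iinf) (n r : ℕ) :
    LinearMap.range (W.f x ^ n) ≤
      Submodule.span k (⋃ m ≥ n, (L.flo x)^[m] '' L.B) ⊔ LinearMap.range (W.f x ^ (n + r)) := by
  induction r with
  | zero => exact le_sup_right
  | succ r ih =>
    refine ih.trans (sup_le le_sup_left ((L.range_pow_le_span_image_sup x (n + r)).trans
      (sup_le_sup_right (Submodule.span_mono ?_) _)))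
    exact Set.subset_iUnion₂_of_subset (n + r) (Nat.le_add_right n r) subset_rfl

/-- A basis element in the span of `S ⊆ B ∪ {0}` belongs to `S`. -/
theorem mem_of_mem_span {S : Set V} (hS : ∀ s ∈ S, s ∈ L.B ∨ s = 0) {b : V} (hb : b ∈ L.B)
    (h : b ∈ Submodule.span k S) : b ∈ S := by
  have hle : S ⊆ insert 0 (Subtype.val '' {s : L.B | (s : V) ∈ S}) := fun s hs => by
    rcases hS s hs with h | h
    · exact Or.inr ⟨⟨s, h⟩, hs, rfl⟩
    · exact Or.inl h
  have h' := Submodule.span_mono hle h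
  rw [Submodule.span_insert_zero] at h'
  by_contra hbS
  exact L.linIndep.notMem_span_image (x := ⟨b, hb⟩) hbS h'

theorem exists_mem_image_of_mem_range (x : D.Iinf) {b : V} (hb : b ∈ L.B) {n : ℕ}
    (hn : b ∈ LinearMap.range (W.f x ^ n)) : ∃ m ≥ n, b ∈ (L.flo x)^[m] '' L.B := by
  obtain ⟨μ, hμ⟩ := L.graded b hb
  obtain ⟨p, hp, hp'⟩ := W.exists_wtProj μ
  obtain ⟨N, hN⟩ := W.exists_bound_wtSp_add_eq_bot x μ
  have hS : ∀ s ∈ ⋃ m ≥ n, (L.flo x)^[m] '' L.B, s ∈ L.B ∨ s = 0 := by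
    intro s hs
    simp only [Set.mem_iUnion] at hs
    obtain ⟨m, -, b', hb', rfl⟩ := hs
    exact L.iterate_flo_mem x m hb'
  obtain ⟨s, hs, w, hw, rfl⟩ := Submodule.mem_sup.mp (L.range_pow_le_span_iUnion_sup x n N hn)
  have hpw := W.proj_range_pow_eq_zero x hp' (hN _ (Nat.le_add_left N n)) hw
  have hps : p s ∈ Submodule.span k (⋃ m ≥ n, (L.flo x)^[m] '' L.B) := by
    refine (?_ : Submodule.map p _ ≤ _) (Submodule.mem_map_of_mem hs)
    rw [Submodule.map_span, Submodule.span_le]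
    rintro _ ⟨t, ht, rfl⟩
    rcases hS t ht with h | h
    · obtain ⟨ν, hν⟩ := L.graded t h
      by_cases hνμ : ν = μ
      · rw [hp t (hνμ ▸ hν)]
        exact Submodule.subset_span ht
      · rw [hp' ν hνμ t hν]
        exact Submodule.zero_mem _
    · simp [h]
  have hmem : s + w ∈ Submodule.span k (⋃ m ≥ n, (L.flo x)^[m] '' L.B) := by
    rw [← hp _ hμ, map_add, hpw, add_zero]
    exact hps
  simpa only [Set.mem_iUnion, exists_prop] using L.mem_of_mem_span hS hb hmem

end LowerPerfectBasis

/-- `d_{il}(b) = max{n ≥ 0 : b ∈ 𝐟_{il}^n(B)}`. -/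
theorem statement2 {I P : Type*} [AddCommGroup P] {D : BCDatum I P}
    {k V : Type*} [Field k] [AddCommGroup V] [Module k V]
    (W : WeakLowerPerfect D k V) (L : LowerPerfectBasis W)
    (b : V) (hb : b ∈ L.B) (x : D.Iinf) :
    IsGreatest {n : ℕ | b ∈ (L.flo x)^[n] '' L.B} (W.d x b) := by
  refine ⟨?_, fun n hn => L.le_d_of_mem_image x hb hn⟩
  obtain ⟨m, hm, hbm⟩ := L.exists_mem_image_of_mem_range x hb (L.mem_range_pow_d x hb)
  rwa [Set.mem_ofPred_eq, ← le_antisymm (L.le_d_of_mem_image x hb hbm) hm]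

end
end

section
/- Let V be a weak lower perfect space with lower perfect basis B, and let p_H : V → V_H = V/(Σ_{(i,l)∈I^∞} 𝚏_{il}V) be the canonical projection. Then the restriction of p_H to B_H is injective, and p_H(B_H) is a basis of the quotient vector space V_H. -/
noncomputable section

open Function Set

namespace WeakLowerPerfect

variable {I P : Type*} [AddCommGroup P] {D : BCDatum I P}
  {k : Type*} [Field k] {V : Type*} [AddCommGroup V] [Module k V]

/-- The projection onto the weight space `wtSp μ` along the other weight spaces. -/
theorem exists_weight_projection (W : WeakLowerPerfect D k V) :
    ∃ π : P → V →ₗ[k] V, (∀ μ v, π μ v ∈ W.wtSp μ) ∧ (∀ μ, ∀ v ∈ W.wtSp μ, π μ v = v) ∧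
      ∀ μ ν, μ ≠ ν → ∀ v ∈ W.wtSp ν, π μ v = 0 := by
  classical
  have hint : DirectSum.IsInternal W.wtSp :=
    (DirectSum.isInternal_submodule_iff_iSupIndep_and_iSup_eq_top W.wtSp).2
      ⟨W.wt_indep, W.wt_total⟩
  let _ := hint.chooseDecomposition
  refine ⟨fun μ => (W.wtSp μ).subtype ∘ₗ DirectSum.component k P _ μ ∘ₗ
    (DirectSum.decomposeLinearEquiv W.wtSp).toLinearMap, fun μ v => ?_, fun μ v hv => ?_,
    fun μ ν h v hv => ?_⟩
  · exact Subtype.prop _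
  · exact DirectSum.decompose_of_mem_same W.wtSp hv
  · exact DirectSum.decompose_of_mem_ne W.wtSp hv h.symm

theorem weight_projection_comm (W : WeakLowerPerfect D k V) {π : P → V →ₗ[k] V}
    (hs : ∀ μ, ∀ v ∈ W.wtSp μ, π μ v = v)
    (hn : ∀ μ ν, μ ≠ ν → ∀ v ∈ W.wtSp ν, π μ v = 0) (x : D.Iinf) (m : ℕ) (μ : P) (v : V) :
    π μ ((W.f x ^ m) v) = (W.f x ^ m) (π (μ + m • D.wtOf x) v) := by
  induction m generalizing μ v with
  | zero => simp
  | succ m ih =>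
    rw [pow_succ, Module.End.mul_apply, ih, Module.End.mul_apply]
    congr 1
    have hv : v ∈ ⨆ μ, W.wtSp μ := W.wt_total ▸ Submodule.mem_top
    refine Submodule.iSup_induction W.wtSp
      (motive := fun v => π (μ + m • D.wtOf x) (W.f x v) =
        W.f x (π (μ + (m + 1) • D.wtOf x) v)) hv (fun ν u hu => ?_) (by simp)
      (fun u w hu hw => by simp [hu, hw])
    have hfu := W.f_wt x ν u hu
    by_cases h : μ + (m + 1) • D.wtOf x = ν
    · have h' : μ + m • D.wtOf x = ν - D.wtOf x := by rw [← h, succ_nsmul]; abel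
      rw [h, h', hs _ _ hu, hs _ _ hfu]
    · have h' : μ + m • D.wtOf x ≠ ν - D.wtOf x := fun e => h (by
        rw [succ_nsmul, ← add_assoc, e]; abel)
      rw [hn _ _ h _ hu, hn _ _ h' _ hfu, map_zero]

theorem wtOf_eq_nsmul (x : D.Iinf) : ∃ i : I, ∃ l : ℕ, 0 < l ∧ D.wtOf x = l • D.α i := by
  rcases x with i | p
  · exact ⟨i.1, 1, one_pos, by simp [BCDatum.wtOf]⟩
  · exact ⟨p.1.1, p.2, p.2.pos, rfl⟩

theorem exists_forall_add_nsmul_ne (x : D.Iinf) (μ lam : P) :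
    ∃ M : ℕ, ∀ m, M ≤ m → ∀ β ∈ D.Rplus, μ + m • D.wtOf x ≠ lam - β := by
  obtain ⟨i, l, hl, hx⟩ := wtOf_eq_nsmul x
  by_contra! hcon
  obtain ⟨m₀, -, β₀, ⟨c₀, rfl⟩, h₀⟩ := hcon 0
  obtain ⟨m, hm, β, ⟨c, rfl⟩, h⟩ := hcon (c₀ i + m₀ * l + 1)
  have key (c : I →₀ ℕ) (m : ℕ) : (c.sum fun i n => n • D.α i) + m • D.wtOf x =
      Finsupp.linearCombination ℤ D.α
        ((c + Finsupp.single i (m * l)).mapRange (Nat.cast : ℕ → ℤ) Nat.cast_zero) := by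
    rw [Finsupp.linearCombination_apply, Finsupp.sum_mapRange_index (by simp),
      Finsupp.sum_add_index' (by simp) (by intros; push_cast; rw [add_smul]),
      Finsupp.sum_single_index (by simp), hx]
    simp [mul_smul]
  have e : (c₀.sum fun i n => n • D.α i) + m₀ • D.wtOf x =
      (c.sum fun i n => n • D.α i) + m • D.wtOf x := by
    have h₁ := eq_sub_iff_add_eq.1 h₀
    have h₂ := eq_sub_iff_add_eq.1 h
    have h₃ := h₁.trans h₂.symm
    rw [add_assoc, add_assoc] at h₃
    rw [add_comm, add_left_cancel h₃, add_comm]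
  rw [key, key] at e
  have e' := DFunLike.congr_fun (D.roots_indep e) i
  simp only [Finsupp.mapRange_apply, Finsupp.add_apply, Finsupp.single_eq_same, Nat.cast_inj] at e'
  have : m ≤ m * l := Nat.le_mul_of_pos_right m hl
  omega

theorem exists_wtSp_eq_bot (W : WeakLowerPerfect D k V) (x : D.Iinf) (μ : P) :
    ∃ M : ℕ, ∀ m, M ≤ m → W.wtSp (μ + m • D.wtOf x) = ⊥ := by
  obtain ⟨Λ, hΛ⟩ := W.wt_bdd
  choose M hM using fun lam => exists_forall_add_nsmul_ne x μ lam
  refine ⟨Λ.sup M, fun m hm => ?_⟩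
  by_contra hne
  obtain ⟨lam, hlam, β, hβ, e⟩ := hΛ _ hne
  exact hM lam m ((Finset.le_sup hlam).trans hm) β hβ e

theorem range_pow_antitone (W : WeakLowerPerfect D k V) (x : D.Iinf) :
    Antitone fun n : ℕ => LinearMap.range (W.f x ^ n) := by
  intro m n h
  obtain ⟨j, rfl⟩ := Nat.exists_eq_add_of_le h
  change LinearMap.range (W.f x ^ (m + j)) ≤ LinearMap.range (W.f x ^ m)
  rw [pow_add]
  exact LinearMap.range_comp_le_range _ _

/-- Some power of `𝚏_{il}` has an image meeting the given weight space trivially. -/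
theorem exists_pow_range_disjoint (W : WeakLowerPerfect D k V) (x : D.Iinf) (μ : P) :
    ∃ M : ℕ, ∀ v ∈ W.wtSp μ, v ∈ LinearMap.range (W.f x ^ M) → v = 0 := by
  obtain ⟨π, hm, hs, hn⟩ := W.exists_weight_projection
  obtain ⟨M, hM⟩ := W.exists_wtSp_eq_bot x μ
  refine ⟨M, ?_⟩
  rintro _ hv ⟨w, rfl⟩
  have h0 : π (μ + M • D.wtOf x) w = 0 := by
    have := hm (μ + M • D.wtOf x) w
    rwa [hM M le_rfl, Submodule.mem_bot] at this
  rw [← hs _ _ hv, W.weight_projection_comm hs hn, h0, map_zero]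

theorem bddAbove_range_pow (W : WeakLowerPerfect D k V) (x : D.Iinf) {μ : P} {v : V}
    (hv : v ∈ W.wtSp μ) (h0 : v ≠ 0) : BddAbove {n | v ∈ LinearMap.range (W.f x ^ n)} := by
  obtain ⟨M, hM⟩ := W.exists_pow_range_disjoint x μ
  refine ⟨M, fun n hn => ?_⟩
  by_contra! h
  exact h0 (hM v hv (W.range_pow_antitone x h.le hn))

theorem mem_range_pow_d (W : WeakLowerPerfect D k V) (x : D.Iinf) {μ : P} {v : V}
    (hv : v ∈ W.wtSp μ) (h0 : v ≠ 0) : v ∈ LinearMap.range (W.f x ^ W.d x v) :=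
  Nat.sSup_mem (s := {n | v ∈ LinearMap.range (W.f x ^ n)}) ⟨0, by simp⟩
    (W.bddAbove_range_pow x hv h0)

theorem le_d (W : WeakLowerPerfect D k V) (x : D.Iinf) {μ : P} {v : V}
    (hv : v ∈ W.wtSp μ) (h0 : v ≠ 0) {n : ℕ} (h : v ∈ LinearMap.range (W.f x ^ n)) :
    n ≤ W.d x v :=
  le_csSup (W.bddAbove_range_pow x hv h0) h

theorem d_eq_zero_iff (W : WeakLowerPerfect D k V) (x : D.Iinf) {μ : P} {v : V}
    (hv : v ∈ W.wtSp μ) (h0 : v ≠ 0) : W.d x v = 0 ↔ v ∉ LinearMap.range (W.f x) := by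
  constructor
  · intro hd hmem
    have := W.le_d x hv h0 (n := 1) (by rwa [pow_one])
    omega
  · intro hmem
    by_contra hd
    refine hmem ?_
    have := W.range_pow_antitone x (Nat.one_le_iff_ne_zero.2 hd) (W.mem_range_pow_d x hv h0)
    simpa using this

end WeakLowerPerfect

namespace LowerPerfectBasis

variable {I P : Type*} [AddCommGroup P] {D : BCDatum I P}
  {k : Type*} [Field k] {V : Type*} [AddCommGroup V] [Module k V]
  {W : WeakLowerPerfect D k V}

theorem ne_zero (L : LowerPerfectBasis W) {b : V} (hb : b ∈ L.B) : b ≠ 0 :=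
  L.linIndep.ne_zero ⟨b, hb⟩

theorem range_pow_le_span_sup_succ (L : LowerPerfectBasis W) (x : D.Iinf) (n : ℕ) :
    LinearMap.range (W.f x ^ n) ≤
      Submodule.span k (L.B ∩ LinearMap.range (W.f x ^ n)) ⊔
        LinearMap.range (W.f x ^ (n + 1)) := by
  induction n with
  | zero => simp [Module.End.one_eq_id, LinearMap.range_id, L.spans]
  | succ n ih =>
    have hstep (m : ℕ) :
        LinearMap.range (W.f x ^ (m + 1)) = (LinearMap.range (W.f x ^ m)).map (W.f x) := by
      rw [pow_succ', Module.End.mul_eq_comp, LinearMap.range_comp]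
    rw [hstep n]
    refine (Submodule.map_mono ih).trans ?_
    rw [Submodule.map_sup, ← hstep, ← hstep]
    refine sup_le ?_ le_sup_right
    rw [Submodule.map_span_le]
    rintro b ⟨hb, hbn⟩
    obtain ⟨μ, hμ⟩ := L.graded b hb
    have hd : n ≤ W.d x b := W.le_d x hμ (L.ne_zero hb) hbn
    obtain ⟨c, hc, happ⟩ := L.flo_approx x b hb
    have happ' : W.f x b - c • L.flo x b ∈ LinearMap.range (W.f x ^ (n + 1 + 1)) :=
      W.range_pow_antitone x (by omega) happ
    rw [← sub_add_cancel (W.f x b) (c • L.flo x b), add_comm (W.f x b - _)]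
    refine Submodule.add_mem_sup (Submodule.smul_mem _ _ ?_) happ'
    rcases L.flo_mem x b hb with hf | hf
    · refine Submodule.subset_span ⟨hf, ?_⟩
      have h₁ : W.f x b ∈ LinearMap.range (W.f x ^ (n + 1)) := by
        rw [hstep]
        exact Submodule.mem_map_of_mem hbn
      have h₂ := sub_mem h₁ (W.range_pow_antitone x (Nat.le_succ (n + 1)) happ')
      rw [sub_sub_cancel] at h₂
      exact (Submodule.smul_mem_iff _ hc).1 h₂
    · rw [hf]
      exact zero_mem _

theorem range_pow_le_span_sup (L : LowerPerfectBasis W) (x : D.Iinf) (n m : ℕ) :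
    LinearMap.range (W.f x ^ n) ≤
      Submodule.span k (L.B ∩ LinearMap.range (W.f x ^ n)) ⊔
        LinearMap.range (W.f x ^ (n + m)) := by
  induction m with
  | zero => exact le_sup_right
  | succ m ih =>
    refine ih.trans (sup_le le_sup_left ((L.range_pow_le_span_sup_succ x (n + m)).trans ?_))
    refine sup_le_sup_right (Submodule.span_mono ?_) _
    exact inter_subset_inter_right _ (W.range_pow_antitone x (Nat.le_add_right n m))

/-- The image of `𝚏_{il}` is spanned by the basis vectors it contains. -/
theorem range_eq_span (L : LowerPerfectBasis W) (x : D.Iinf) :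
    LinearMap.range (W.f x) = Submodule.span k (L.B ∩ LinearMap.range (W.f x)) := by
  refine le_antisymm ?_ (Submodule.span_le.2 inter_subset_right)
  obtain ⟨π, hm, hs, hn⟩ := W.exists_weight_projection
  rw [LinearMap.range_eq_map (W.f x), ← L.spans, Submodule.map_span_le]
  intro b hb
  rw [L.spans, ← LinearMap.range_eq_map]
  obtain ⟨ν, hν⟩ := L.graded b hb
  set μ := ν - D.wtOf x
  have hfb : W.f x b ∈ W.wtSp μ := W.f_wt x ν b hν
  obtain ⟨M, hM⟩ := W.exists_wtSp_eq_bot x μ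
  have hmem := L.range_pow_le_span_sup x 1 M
  rw [pow_one] at hmem
  replace hmem := hmem (LinearMap.mem_range_self (W.f x) b)
  obtain ⟨s, hsU, _, ⟨w, rfl⟩, e⟩ := Submodule.mem_sup.1 hmem
  have h0 : π (μ + (1 + M) • D.wtOf x) w = 0 := by
    have := hm (μ + (1 + M) • D.wtOf x) w
    rwa [hM _ (by omega), Submodule.mem_bot] at this
  rw [← hs _ _ hfb, ← e, map_add, W.weight_projection_comm hs hn, h0, map_zero, add_zero]
  refine (Submodule.map_span_le (π μ) _ _).2 ?_ (Submodule.mem_map_of_mem hsU)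
  intro b' hb'
  obtain ⟨ν', hν'⟩ := L.graded b' hb'.1
  by_cases h : μ = ν'
  · rw [h, hs _ _ hν']
    exact Submodule.subset_span hb'
  · rw [hn _ _ h _ hν']
    exact zero_mem _

theorem mem_BH_iff (L : LowerPerfectBasis W) {b : V} :
    b ∈ L.BH ↔ b ∈ L.B ∧ ∀ x, b ∉ LinearMap.range (W.f x) := by
  refine and_congr_right fun hb => forall_congr' fun x => ?_
  obtain ⟨μ, hμ⟩ := L.graded b hb
  exact W.d_eq_zero_iff x hμ (L.ne_zero hb)

/-- `Σ_{(i,l)} 𝚏_{il}V` is spanned by the basis vectors outside `B_H`. -/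
theorem iSup_range_eq_span (L : LowerPerfectBasis W) :
    ⨆ x : D.Iinf, LinearMap.range (W.f x) = Submodule.span k (L.B \ L.BH) := by
  have hset : L.B \ L.BH = ⋃ x : D.Iinf, L.B ∩ LinearMap.range (W.f x) := by
    ext b
    simp only [mem_sdiff, L.mem_BH_iff, mem_iUnion, mem_inter_iff, SetLike.mem_coe]
    push Not
    exact ⟨fun ⟨hb, h⟩ => (h hb).imp fun _ hx => ⟨hb, hx⟩,
      fun ⟨x, hb, hx⟩ => ⟨hb, fun _ => ⟨x, hx⟩⟩⟩
  rw [hset, Submodule.span_iUnion]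
  exact iSup_congr L.range_eq_span

end LowerPerfectBasis

/-- `p_H` is injective on `B_H`, and `p_H(B_H)` is a basis of
`V_H = V/(Σ_{(i,l)} 𝚏_{il}V)`. -/
theorem statement12 {I P : Type*} [AddCommGroup P] {D : BCDatum I P}
    {k V : Type*} [Field k] [AddCommGroup V] [Module k V]
    (W : WeakLowerPerfect D k V) (L : LowerPerfectBasis W) :
    Set.InjOn (⇑(⨆ x : D.Iinf, LinearMap.range (W.f x)).mkQ) L.BH ∧
    LinearIndependent k
      (Subtype.val :
        ((⨆ x : D.Iinf, LinearMap.range (W.f x)).mkQ '' L.BH :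
          Set (V ⧸ ⨆ x : D.Iinf, LinearMap.range (W.f x))) →
        V ⧸ ⨆ x : D.Iinf, LinearMap.range (W.f x)) ∧
    Submodule.span k ((⨆ x : D.Iinf, LinearMap.range (W.f x)).mkQ '' L.BH) = ⊤ := by
  have hsub : L.BH ⊆ L.B := fun _ h => h.1
  rw [L.iSup_range_eq_span]
  have hB : LinearIndepOn k id L.B := L.linIndep
  have hdisj : Disjoint (Submodule.span k L.BH) (Submodule.span k (L.B \ L.BH)) := by
    have := L.linIndep.disjoint_span_image
      (s := Subtype.val ⁻¹' L.BH) (t := Subtype.val ⁻¹' (L.B \ L.BH))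
      (disjoint_sdiff_right.preimage _)
    rwa [Subtype.image_preimage_coe, Subtype.image_preimage_coe,
      inter_eq_right.2 hsub, inter_eq_right.2 sdiff_subset] at this
  have hli : LinearIndepOn k (Submodule.span k (L.B \ L.BH)).mkQ L.BH := by
    refine (hB.mono hsub).map (f := (Submodule.span k (L.B \ L.BH)).mkQ) ?_
    simpa using hdisj
  refine ⟨hli.injOn, hli.id_image, ?_⟩
  rw [← Submodule.map_span, Submodule.map_mkQ_eq_top, ← Submodule.span_union,
    sdiff_union_of_subset hsub, L.spans]

end
end
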